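/- A well-tempered scoring game G is invertible (there exists H with G + H ≈ 0) if and only if G ≈ K for some game K with gap_0(K) = 0, if and only if G - G ≈ 0. -/

import Mathlib

/-- Well-tempered scoring game trees: an integer (final score) or a position
with lists of Left and Right options. -/
inductive WT : Type where
  | int : ℤ → WT
  | node : List WT → List WT → WT

namespace WT

/-- Left options. -/
def lopts : WT → List WT
  | int _ => []
  | node L _ => L

/-- Right options. -/
def ropts : WT → List WT
  | int _ => []
  | node _ R => R

theorem sizeOf_lt_of_mem_lopts : ∀ {G g : WT}, g ∈ G.lopts → sizeOf g < sizeOf G := by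
  intro G g h
  cases G with
  | int n => simp [lopts] at h
  | node L R =>
    simp only [lopts] at h
    have h1 := List.sizeOf_lt_of_mem h
    have h2 : sizeOf (WT.node L R) = 1 + sizeOf L + sizeOf R := by simp
    omega

theorem sizeOf_lt_of_mem_ropts : ∀ {G g : WT}, g ∈ G.ropts → sizeOf g < sizeOf G := by
  intro G g h
  cases G with
  | int n => simp [ropts] at h
  | node L R =>
    simp only [ropts] at h
    have h1 := List.sizeOf_lt_of_mem h
    have h2 : sizeOf (WT.node L R) = 1 + sizeOf L + sizeOf R := by simp
    omega

/-- Disjunctive sum of two games. -/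
def add (G H : WT) : WT :=
  match G, H with
  | int m, int n => int (m + n)
  | G, H =>
    node ((G.lopts.attach.map fun g => add g.1 H) ++ (H.lopts.attach.map fun h => add G h.1))
         ((G.ropts.attach.map fun g => add g.1 H) ++ (H.ropts.attach.map fun h => add G h.1))
termination_by sizeOf G + sizeOf H
decreasing_by
  all_goals
    first
      | (have := sizeOf_lt_of_mem_lopts g.2; omega)
      | (have := sizeOf_lt_of_mem_lopts h.2; omega)
      | (have := sizeOf_lt_of_mem_ropts g.2; omega)
      | (have := sizeOf_lt_of_mem_ropts h.2; omega)

/-- Negation of a game: swap players and negate scores. -/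
def neg : WT → WT
  | int n => int (-n)
  | node L R =>
    node ((WT.node L R).ropts.attach.map fun g => neg g.1)
         ((WT.node L R).lopts.attach.map fun g => neg g.1)
termination_by G => sizeOf G
decreasing_by
  all_goals
    first
      | exact sizeOf_lt_of_mem_lopts g.2
      | exact sizeOf_lt_of_mem_ropts g.2

def lmax : List ℤ → ℤ
  | [] => 0
  | x :: xs => xs.foldl max x

def lmin : List ℤ → ℤ
  | [] => 0
  | x :: xs => xs.foldl min x

/-- The pair (left outcome, right outcome). -/
def out : WT → ℤ × ℤ
  | int n => (n, n)
  | node L R =>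
    (lmax ((WT.node L R).lopts.attach.map fun g => (out g.1).2),
     lmin ((WT.node L R).ropts.attach.map fun g => (out g.1).1))
termination_by G => sizeOf G
decreasing_by
  all_goals
    first
      | exact sizeOf_lt_of_mem_lopts g.2
      | exact sizeOf_lt_of_mem_ropts g.2

/-- Left outcome L(G): optimal score when Left moves first. -/
def Lout (G : WT) : ℤ := G.out.1

/-- Right outcome R(G): optimal score when Right moves first. -/
def Rout (G : WT) : ℤ := G.out.2

/-- `IsWT G p` : `G` is a well-tempered game of parity `p`
(`false` = even-tempered, `true` = odd-tempered). -/
inductive IsWT : WT → Bool → Prop where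
  | int (n : ℤ) : IsWT (WT.int n) false
  | node {L R : List WT} {p : Bool} (hL : L ≠ []) (hR : R ≠ [])
      (hLp : ∀ g ∈ L, IsWT g p) (hRp : ∀ g ∈ R, IsWT g p) :
      IsWT (WT.node L R) (!p)

/-- `G` is a well-tempered game (of some parity). -/
def Wt (G : WT) : Prop := ∃ p, IsWT G p

/-- Parity, computed structurally (`false` = even-tempered, `true` = odd-tempered;
agrees with `IsWT` on well-tempered games). -/
def par : WT → Bool
  | int _ => false
  | node [] _ => true
  | node (g :: _) _ => !(par g)

/-- Final score under optimal play when Left moves last. -/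
def Lf (G : WT) : ℤ := if G.par then G.Lout else G.Rout

/-- Final score under optimal play when Right moves last. -/
def Rf (G : WT) : ℤ := if G.par then G.Rout else G.Lout

/-- `G ≲ H` : for every well-tempered `X`, `L(G+X) ≤ L(H+X)` and `R(G+X) ≤ R(H+X)`. -/
def Le (G H : WT) : Prop :=
  ∀ X : WT, X.Wt → (G.add X).Lout ≤ (H.add X).Lout ∧ (G.add X).Rout ≤ (H.add X).Rout

/-- `G ≳ H`. -/
def Ge (G H : WT) : Prop := Le H G

/-- `G ≈ H` : equivalence of scoring games. -/
def Equiv (G H : WT) : Prop :=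
  ∀ X : WT, X.Wt → (G.add X).Lout = (H.add X).Lout ∧ (G.add X).Rout = (H.add X).Rout

/-- `G` and `H` are well-tempered with the same parity. -/
def SamePar (G H : WT) : Prop := ∃ p, IsWT G p ∧ IsWT H p

/-- `G` takes values in `S`: every integer subgame lies in `S`. -/
inductive Valued (S : Set ℤ) : WT → Prop where
  | int {n : ℤ} : n ∈ S → Valued S (WT.int n)
  | node {L R : List WT} : (∀ g ∈ L, Valued S g) → (∀ g ∈ R, Valued S g) →
      Valued S (WT.node L R)

/-- `Subgame H G` : `H` is a subgame of `G`. -/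
inductive Subgame : WT → WT → Prop where
  | refl (G : WT) : Subgame G G
  | left {H G' : WT} {L R : List WT} : G' ∈ L → Subgame H G' → Subgame H (WT.node L R)
  | right {H G' : WT} {L R : List WT} : G' ∈ R → Subgame H G' → Subgame H (WT.node L R)

/-- `gap G p` : supremum of `R(H) - L(H)` over subgames `H` of `G` of parity `p`
(as an element of `WithBot ℤ`; the supremum of the empty set is `⊥ = -∞`). -/
noncomputable def gap (G : WT) (p : Bool) : WithBot ℤ :=
  sSup {x : WithBot ℤ | ∃ H : WT, Subgame H G ∧ IsWT H p ∧ x = ((H.Rout - H.Lout : ℤ) : WithBot ℤ)}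

/-- Heating by `t`. -/
def heat (t : ℤ) : WT → WT
  | int n => int n
  | node L R =>
    node ((WT.node L R).lopts.attach.map fun g => (WT.int t).add (heat t g.1))
         ((WT.node L R).ropts.attach.map fun g => (WT.int (-t)).add (heat t g.1))
termination_by G => sizeOf G
decreasing_by
  all_goals
    first
      | exact sizeOf_lt_of_mem_lopts g.2
      | exact sizeOf_lt_of_mem_ropts g.2

end WT

namespace WT

/-! ### Options of sums and negatives -/

theorem opt_induction {motive : WT → Prop}
    (h : ∀ G : WT, (∀ g ∈ G.lopts, motive g) → (∀ g ∈ G.ropts, motive g) → motive G)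
    (G : WT) : motive G :=
  h G (fun g _ => opt_induction h g) (fun g _ => opt_induction h g)
termination_by sizeOf G
decreasing_by
  · exact sizeOf_lt_of_mem_lopts (by assumption)
  · exact sizeOf_lt_of_mem_ropts (by assumption)

theorem int_add_int (m n : ℤ) : (int m).add (int n) = int (m + n) := by
  rw [add]

theorem node_add (L R : List WT) (H : WT) :
    (node L R).add H =
      node (L.map (fun g => g.add H) ++ H.lopts.map (fun h => (node L R).add h))
        (R.map (fun g => g.add H) ++ H.ropts.map (fun h => (node L R).add h)) := by
  rw [add]
  · simp [lopts, ropts]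
  · simp

theorem node_add_node (L R L' R' : List WT) :
    (node L R).add (node L' R') =
      node (L.map (fun g => g.add (node L' R')) ++ L'.map (fun h => (node L R).add h))
        (R.map (fun g => g.add (node L' R')) ++ R'.map (fun h => (node L R).add h)) :=
  node_add L R _

theorem node_add_int (L R : List WT) (n : ℤ) :
    (node L R).add (int n) =
      node (L.map (fun g => g.add (int n))) (R.map (fun g => g.add (int n))) := by
  rw [node_add]
  simp [lopts, ropts]

theorem int_add_node (n : ℤ) (L R : List WT) :
    (int n).add (node L R) =
      node (L.map (fun h => (int n).add h)) (R.map (fun h => (int n).add h)) := by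
  rw [add]
  · simp [lopts, ropts]
  · simp

theorem neg_int (n : ℤ) : (int n).neg = int (-n) := by
  rw [neg]

theorem neg_node (L R : List WT) : (node L R).neg = node (R.map neg) (L.map neg) := by
  rw [neg]
  simp [lopts, ropts]

theorem lopts_add (G H : WT) :
    (G.add H).lopts = G.lopts.map (fun g => g.add H) ++ H.lopts.map (fun h => G.add h) := by
  cases G <;> cases H <;> simp [int_add_int, int_add_node, node_add_int, node_add_node, lopts]

theorem ropts_add (G H : WT) :
    (G.add H).ropts = G.ropts.map (fun g => g.add H) ++ H.ropts.map (fun h => G.add h) := by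
  cases G <;> cases H <;> simp [int_add_int, int_add_node, node_add_int, node_add_node, ropts]

theorem lopts_neg (G : WT) : G.neg.lopts = G.ropts.map neg := by
  cases G <;> simp [neg_int, neg_node, lopts, ropts]

theorem ropts_neg (G : WT) : G.neg.ropts = G.lopts.map neg := by
  cases G <;> simp [neg_int, neg_node, lopts, ropts]

theorem add_eq_int_iff {G H : WT} {k : ℤ} :
    G.add H = int k ↔ ∃ m n, G = int m ∧ H = int n ∧ m + n = k := by
  cases G <;> cases H <;> simp [int_add_int, int_add_node, node_add_int, node_add_node]

theorem neg_eq_int_iff {G : WT} {k : ℤ} : G.neg = int k ↔ G = int (-k) := by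
  cases G <;> simp [neg_int, neg_node, neg_eq_iff_eq_neg]

theorem ext_opts {G H : WT} (hn : ∀ n, G = int n ↔ H = int n) (hl : G.lopts = H.lopts)
    (hr : G.ropts = H.ropts) : G = H := by
  cases G with
  | int n => exact ((hn n).1 rfl).symm
  | node L R =>
    cases H with
    | int n => exact (hn n).2 rfl
    | node L' R' => rw [node.injEq]; exact ⟨hl, hr⟩

theorem neg_neg (G : WT) : G.neg.neg = G := by
  induction G using opt_induction with
  | h G hl hr =>
    refine ext_opts (fun n => by simp [neg_eq_int_iff]) ?_ ?_
    · rw [lopts_neg, ropts_neg, List.map_map]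
      exact (List.map_congr_left hl).trans (List.map_id _)
    · rw [ropts_neg, lopts_neg, List.map_map]
      exact (List.map_congr_left hr).trans (List.map_id _)

theorem neg_add (G H : WT) : (G.add H).neg = G.neg.add H.neg := by
  induction G using opt_induction generalizing H with
  | h G gl gr =>
    induction H using opt_induction with
    | h H hl hr =>
      refine ext_opts (fun n => ?_) ?_ ?_
      · simp only [neg_eq_int_iff, add_eq_int_iff]
        constructor
        · rintro ⟨a, b, rfl, rfl, e⟩
          exact ⟨-a, -b, by simp, by simp, by omega⟩
        · rintro ⟨a, b, rfl, rfl, e⟩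
          exact ⟨-a, -b, rfl, rfl, by omega⟩
      · simp only [lopts_neg, ropts_add, lopts_add, List.map_append, List.map_map]
        exact congrArg₂ _ (List.map_congr_left fun g hg => gr g hg H) (List.map_congr_left hr)
      · simp only [ropts_neg, ropts_add, lopts_add, List.map_append, List.map_map]
        exact congrArg₂ _ (List.map_congr_left fun g hg => gl g hg H) (List.map_congr_left hl)

theorem add_zero (G : WT) : G.add (int 0) = G := by
  induction G using opt_induction with
  | h G hl hr =>
    refine ext_opts (fun n => by simp [add_eq_int_iff]) ?_ ?_
    · rw [lopts_add]
      simpa [lopts] using (List.map_congr_left hl).trans (List.map_id _)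
    · rw [ropts_add]
      simpa [ropts] using (List.map_congr_left hr).trans (List.map_id _)

theorem zero_add (G : WT) : (int 0).add G = G := by
  induction G using opt_induction with
  | h G hl hr =>
    refine ext_opts (fun n => by simp [add_eq_int_iff]) ?_ ?_
    · rw [lopts_add]
      simpa [lopts] using (List.map_congr_left hl).trans (List.map_id _)
    · rw [ropts_add]
      simpa [ropts] using (List.map_congr_left hr).trans (List.map_id _)

theorem add_assoc (G H K : WT) : (G.add H).add K = G.add (H.add K) := by
  induction G using opt_induction generalizing H K with
  | h G gl gr =>
    induction H using opt_induction generalizing K with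
    | h H hl hr =>
      induction K using opt_induction with
      | h K kl kr =>
        refine ext_opts (fun n => ?_) ?_ ?_
        · simp only [add_eq_int_iff]
          constructor
          · rintro ⟨_, c, ⟨a, b, rfl, rfl, rfl⟩, rfl, e⟩
            exact ⟨a, b + c, rfl, ⟨b, c, rfl, rfl, rfl⟩, by omega⟩
          · rintro ⟨a, _, rfl, ⟨b, c, rfl, rfl, rfl⟩, e⟩
            exact ⟨a + b, c, ⟨a, b, rfl, rfl, rfl⟩, rfl, by omega⟩
        · simp only [lopts_add, List.map_append, List.map_map, List.append_assoc]
          exact congrArg₂ _ (List.map_congr_left fun g hg => gl g hg H K)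
            (congrArg₂ _ (List.map_congr_left fun h hh => hl h hh K) (List.map_congr_left kl))
        · simp only [ropts_add, List.map_append, List.map_map, List.append_assoc]
          exact congrArg₂ _ (List.map_congr_left fun g hg => gr g hg H K)
            (congrArg₂ _ (List.map_congr_left fun h hh => hr h hh K) (List.map_congr_left kr))

/-! ### Outcomes -/

theorem foldl_max_mem (l : List ℤ) (x : ℤ) : l.foldl max x ∈ x :: l := by
  induction l generalizing x with
  | nil => simp
  | cons y l ih =>
    have := ih (max x y)
    rcases max_choice x y with h | h <;> simp only [List.foldl_cons, h] at this ⊢ <;>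
      simp only [List.mem_cons] at this ⊢ <;> tauto

theorem le_foldl_max (l : List ℤ) (x : ℤ) : ∀ y ∈ x :: l, y ≤ l.foldl max x := by
  induction l generalizing x with
  | nil => simp
  | cons z l ih =>
    have := ih (max x z)
    simp only [List.mem_cons, forall_eq_or_imp, List.foldl_cons] at this ⊢
    exact ⟨(le_max_left _ _).trans this.1, (le_max_right _ _).trans this.1, this.2⟩

theorem lmax_mem {l : List ℤ} (h : l ≠ []) : lmax l ∈ l := by
  cases l with
  | nil => exact absurd rfl h
  | cons x l => exact foldl_max_mem l x

theorem le_lmax {l : List ℤ} {x : ℤ} (h : x ∈ l) : x ≤ lmax l := by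
  cases l with
  | nil => simp at h
  | cons y l => exact le_foldl_max l y x h

theorem foldl_min_eq (l : List ℤ) (x : ℤ) :
    l.foldl min x = -(l.map Neg.neg).foldl max (-x) := by
  induction l generalizing x with
  | nil => simp
  | cons y l ih => simp [ih, max_neg_neg]

theorem lmin_eq (l : List ℤ) : lmin l = -lmax (l.map Neg.neg) := by
  cases l with
  | nil => simp [lmin, lmax]
  | cons x l => simp [lmin, lmax, foldl_min_eq]

theorem Lout_int (n : ℤ) : (int n).Lout = n := by
  rw [Lout, out]

theorem Rout_int (n : ℤ) : (int n).Rout = n := by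
  rw [Rout, out]

theorem Lout_node (L R : List WT) : (node L R).Lout = lmax (L.map Rout) := by
  rw [Lout, out]
  simp [lopts]
  rfl

theorem Rout_node (L R : List WT) : (node L R).Rout = lmin (R.map Lout) := by
  rw [Rout, out]
  simp [ropts]
  rfl

theorem Lout_neg_and_Rout_neg (G : WT) : G.neg.Lout = -G.Rout ∧ G.neg.Rout = -G.Lout := by
  induction G using opt_induction with
  | h G hl hr =>
    cases G with
    | int n => simp [neg_int, Lout_int, Rout_int]
    | node L R =>
      simp only [lopts, ropts] at hl hr
      simp only [neg_node, Lout_node, Rout_node, lmin_eq, List.map_map, _root_.neg_neg]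
      refine ⟨congrArg lmax (List.map_congr_left fun g hg => ?_),
        congrArg (fun l => -lmax l) (List.map_congr_left fun g hg => ?_)⟩
      · simp [(hr g hg).2]
      · simp [(hl g hg).1]

theorem Lout_neg (G : WT) : G.neg.Lout = -G.Rout := (Lout_neg_and_Rout_neg G).1

theorem Rout_neg (G : WT) : G.neg.Rout = -G.Lout := (Lout_neg_and_Rout_neg G).2

theorem Rout_le_Lout_of_mem {G g : WT} (h : g ∈ G.lopts) : g.Rout ≤ G.Lout := by
  cases G with
  | int n => simp [lopts] at h
  | node L R =>
    rw [Lout_node]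
    exact le_lmax (List.mem_map_of_mem h)

theorem exists_Rout_eq_Lout {G : WT} (h : G.lopts ≠ []) : ∃ g ∈ G.lopts, g.Rout = G.Lout := by
  cases G with
  | int n => simp [lopts] at h
  | node L R =>
    rw [Lout_node]
    exact List.mem_map.1 (lmax_mem (by simpa [lopts] using h))

theorem Rout_le_Lout_of_mem_ropts {G g : WT} (h : g ∈ G.ropts) : G.Rout ≤ g.Lout := by
  have := Rout_le_Lout_of_mem (G := G.neg) (g := g.neg)
    (by rw [lopts_neg]; exact List.mem_map_of_mem h)
  rw [Rout_neg, Lout_neg] at this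
  omega

theorem exists_Lout_eq_Rout {G : WT} (h : G.ropts ≠ []) : ∃ g ∈ G.ropts, g.Lout = G.Rout := by
  obtain ⟨g, hg, e⟩ := exists_Rout_eq_Lout (G := G.neg) (by simpa [lopts_neg] using h)
  rw [lopts_neg] at hg
  obtain ⟨g, hg', rfl⟩ := List.mem_map.1 hg
  rw [Rout_neg, Lout_neg] at e
  exact ⟨g, hg', by omega⟩

/-! ### Parity -/

theorem IsWT.eq_int_or {G : WT} {p : Bool} (h : IsWT G p) :
    (∃ n, G = WT.int n) ∨ (G.lopts ≠ [] ∧ G.ropts ≠ []) := by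
  cases h with
  | int n => exact Or.inl ⟨n, rfl⟩
  | node hL hR _ _ => exact Or.inr ⟨hL, hR⟩

theorem IsWT.lopt {G g : WT} {p : Bool} (h : IsWT G p) (hg : g ∈ G.lopts) : IsWT g (!p) := by
  cases h with
  | int n => simp [lopts] at hg
  | node _ _ hL _ => simpa using hL g hg

theorem IsWT.ropt {G g : WT} {p : Bool} (h : IsWT G p) (hg : g ∈ G.ropts) : IsWT g (!p) := by
  cases h with
  | int n => simp [ropts] at hg
  | node _ _ _ hR => simpa using hR g hg

theorem IsWT.lopts_ne_nil {G : WT} (h : IsWT G true) : G.lopts ≠ [] := by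
  rcases h.eq_int_or with ⟨n, rfl⟩ | h'
  · cases h
  · exact h'.1

theorem IsWT.node' {L R : List WT} {p : Bool} (hL : L ≠ []) (hR : R ≠ [])
    (hLp : ∀ g ∈ L, IsWT g (!p)) (hRp : ∀ g ∈ R, IsWT g (!p)) : IsWT (WT.node L R) p := by
  simpa using IsWT.node hL hR hLp hRp

theorem IsWT.unique {G : WT} {p q : Bool} (hp : IsWT G p) (hq : IsWT G q) : p = q := by
  induction hp generalizing q with
  | int n => cases hq; rfl
  | @node L R p hL _ _ _ ih _ =>
    cases hq with
    | node _ _ hLq _ =>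
      obtain ⟨g, hg⟩ := List.exists_mem_of_ne_nil L hL
      rw [ih g hg (hLq g hg)]

theorem IsWT.neg {G : WT} {p : Bool} (h : IsWT G p) : IsWT G.neg p := by
  induction h with
  | int n => rw [neg_int]; exact .int _
  | node hL hR _ _ ihL ihR =>
    rw [neg_node]
    refine .node (by simpa using hR) (by simpa using hL) ?_ ?_ <;>
      simpa [List.mem_map] using by assumption

theorem IsWT.add {G H : WT} {p q : Bool} (hG : IsWT G p) (hH : IsWT H q) :
    IsWT (G.add H) (p ^^ q) := by
  induction G using opt_induction generalizing H p q with
  | h G gl gr =>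
    induction H using opt_induction generalizing q with
    | h H hl hr =>
      have key : ∀ L R, G.add H = WT.node L R → IsWT (G.add H) (p ^^ q) := by
        intro L R e
        have eL : L = (G.add H).lopts := by rw [e]; rfl
        have eR : R = (G.add H).ropts := by rw [e]; rfl
        have hn : (G.lopts ≠ [] ∧ G.ropts ≠ []) ∨ (H.lopts ≠ [] ∧ H.ropts ≠ []) := by
          rcases hG.eq_int_or with ⟨m, rfl⟩ | h
          · rcases hH.eq_int_or with ⟨n, rfl⟩ | h
            · rw [int_add_int] at e; cases e
            · exact Or.inr h
          · exact Or.inl h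
        rw [lopts_add] at eL
        rw [ropts_add] at eR
        rw [e]
        refine IsWT.node' ?_ ?_ ?_ ?_
        · subst eL; simp; tauto
        · subst eR; simp; tauto
        · subst eL
          simp only [List.mem_append, List.mem_map]
          rintro _ (⟨g, hg, rfl⟩ | ⟨g, hg, rfl⟩)
          · simpa using gl g hg (hG.lopt hg) hH
          · simpa using hl g hg (hH.lopt hg)
        · subst eR
          simp only [List.mem_append, List.mem_map]
          rintro _ (⟨g, hg, rfl⟩ | ⟨g, hg, rfl⟩)
          · simpa using gr g hg (hG.ropt hg) hH
          · simpa using hr g hg (hH.ropt hg)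
      cases e : G.add H with
      | node L R => exact e ▸ key L R e
      | int n =>
        cases G <;> cases H <;> simp only [int_add_int, int_add_node, node_add_int, node_add_node] at e <;>
          cases e
        cases hG; cases hH; exact .int _

theorem Wt.add {G H : WT} (hG : G.Wt) (hH : H.Wt) : (G.add H).Wt :=
  ⟨_, hG.choose_spec.add hH.choose_spec⟩

theorem Wt.neg {G : WT} (hG : G.Wt) : G.neg.Wt := ⟨_, hG.choose_spec.neg⟩

theorem Wt.int (n : ℤ) : (int n).Wt := ⟨_, .int n⟩

/-! ### Outcomes of sums -/

theorem le_Lout_add_left {G g : WT} (X : WT) (h : g ∈ G.lopts) :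
    (g.add X).Rout ≤ (G.add X).Lout :=
  Rout_le_Lout_of_mem (by rw [lopts_add]; exact List.mem_append_left _ (List.mem_map_of_mem h))

theorem le_Lout_add_right (G : WT) {X x : WT} (h : x ∈ X.lopts) :
    (G.add x).Rout ≤ (G.add X).Lout :=
  Rout_le_Lout_of_mem (by
    rw [lopts_add]
    exact List.mem_append_right _ (List.mem_map_of_mem (f := fun x => G.add x) h))

theorem Rout_add_le_left {G g : WT} (X : WT) (h : g ∈ G.ropts) :
    (G.add X).Rout ≤ (g.add X).Lout :=
  Rout_le_Lout_of_mem_ropts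
    (by rw [ropts_add]; exact List.mem_append_left _ (List.mem_map_of_mem h))

theorem Rout_add_le_right (G : WT) {X x : WT} (h : x ∈ X.ropts) :
    (G.add X).Rout ≤ (G.add x).Lout :=
  Rout_le_Lout_of_mem_ropts (by
    rw [ropts_add]
    exact List.mem_append_right _ (List.mem_map_of_mem (f := fun x => G.add x) h))

theorem le_Rout_add {G X : WT} {p q : Bool} (hG : IsWT G p) (hX : IsWT X q) {c : ℤ}
    (h₁ : ∀ g ∈ G.ropts, c ≤ (g.add X).Lout) (h₂ : ∀ x ∈ X.ropts, c ≤ (G.add x).Lout)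
    (h₀ : ∀ m n, G = WT.int m → X = WT.int n → c ≤ m + n) : c ≤ (G.add X).Rout := by
  rcases (hG.add hX).eq_int_or with ⟨k, e⟩ | ⟨_, h⟩
  · cases G <;> cases X <;> simp only [int_add_int, int_add_node, node_add_int, node_add_node] at e <;> cases e
    rw [int_add_int, Rout_int]
    exact h₀ _ _ rfl rfl
  · obtain ⟨y, hy, e⟩ := exists_Lout_eq_Rout h
    rw [ropts_add] at hy
    simp only [List.mem_append, List.mem_map] at hy
    rw [← e]
    rcases hy with ⟨g, hg, rfl⟩ | ⟨g, hg, rfl⟩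
    · exact h₁ g hg
    · exact h₂ g hg

theorem Lout_add_le {G X : WT} {p q : Bool} (hG : IsWT G p) (hX : IsWT X q) {c : ℤ}
    (h₁ : ∀ g ∈ G.lopts, (g.add X).Rout ≤ c) (h₂ : ∀ x ∈ X.lopts, (G.add x).Rout ≤ c)
    (h₀ : ∀ m n, G = WT.int m → X = WT.int n → m + n ≤ c) : (G.add X).Lout ≤ c := by
  rcases (hG.add hX).eq_int_or with ⟨k, e⟩ | ⟨h, _⟩
  · cases G <;> cases X <;> simp only [int_add_int, int_add_node, node_add_int, node_add_node] at e <;> cases e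
    rw [int_add_int, Lout_int]
    exact h₀ _ _ rfl rfl
  · obtain ⟨y, hy, e⟩ := exists_Rout_eq_Lout h
    rw [lopts_add] at hy
    simp only [List.mem_append, List.mem_map] at hy
    rw [← e]
    rcases hy with ⟨g, hg, rfl⟩ | ⟨g, hg, rfl⟩
    · exact h₁ g hg
    · exact h₂ g hg

theorem out_add_int {G : WT} {p : Bool} (hG : IsWT G p) (n : ℤ) :
    (G.add (int n)).Lout = G.Lout + n ∧ (G.add (int n)).Rout = G.Rout + n := by
  induction G using opt_induction generalizing p with
  | h G gl gr =>
    rcases hG.eq_int_or with ⟨m, rfl⟩ | ⟨hl, hr⟩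
    · simp [int_add_int, Lout_int, Rout_int]
    · obtain ⟨l, hl, el⟩ := exists_Rout_eq_Lout hl
      obtain ⟨r, hr, er⟩ := exists_Lout_eq_Rout hr
      refine ⟨le_antisymm ?_ ?_, le_antisymm ?_ ?_⟩
      · refine Lout_add_le hG (.int n) (fun g hg => ?_) (by simp [lopts]) ?_
        · rw [(gl g hg (hG.lopt hg)).2]
          linarith [Rout_le_Lout_of_mem hg]
        · rintro m _ rfl; simp [lopts] at hl
      · rw [← el, ← (gl l hl (hG.lopt hl)).2]
        exact le_Lout_add_left _ hl
      · rw [← er, ← (gr r hr (hG.ropt hr)).1]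
        exact Rout_add_le_left _ hr
      · refine le_Rout_add hG (.int n) (fun g hg => ?_) (by simp [ropts]) ?_
        · rw [(gr g hg (hG.ropt hg)).1]
          linarith [Rout_le_Lout_of_mem_ropts hg]
        · rintro m _ rfl; simp [lopts] at hl

theorem lmax_congr {l l' : List ℤ} (h : ∀ x, x ∈ l ↔ x ∈ l') : lmax l = lmax l' := by
  by_cases hl : l = []
  · subst hl
    rw [List.eq_nil_iff_forall_not_mem (l := l') |>.2 fun x hx => by simpa using (h x).2 hx]
  · have hl' : l' ≠ [] := fun e => by
      subst e
      exact hl (List.eq_nil_iff_forall_not_mem.2 fun x hx => by simpa using (h x).1 hx)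
    exact le_antisymm (le_lmax ((h _).1 (lmax_mem hl))) (le_lmax ((h _).2 (lmax_mem hl')))

theorem Lout_eq {G H : WT} (hn : (∃ n, G = int n) ↔ ∃ n, H = int n)
    (h₀ : ∀ m n, G = int m → H = int n → m = n)
    (h : ∀ x, (∃ g ∈ G.lopts, g.Rout = x) ↔ ∃ g ∈ H.lopts, g.Rout = x) :
    G.Lout = H.Lout := by
  cases G <;> cases H <;> simp at hn h₀
  · rw [h₀]
  · rw [Lout_node, Lout_node]
    exact lmax_congr (by simpa [lopts] using h)

theorem Rout_eq {G H : WT} (hn : (∃ n, G = int n) ↔ ∃ n, H = int n)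
    (h₀ : ∀ m n, G = int m → H = int n → m = n)
    (h : ∀ x, (∃ g ∈ G.ropts, g.Lout = x) ↔ ∃ g ∈ H.ropts, g.Lout = x) :
    G.Rout = H.Rout := by
  cases G <;> cases H <;> simp at hn h₀
  · rw [h₀]
  · rw [Rout_node, Rout_node, lmin_eq, lmin_eq]
    refine congrArg _ (lmax_congr fun x => ?_)
    have := h (-x)
    simpa [ropts, neg_eq_iff_eq_neg] using this

theorem out_add_comm_add (G H X : WT) :
    ((G.add H).add X).Lout = ((H.add G).add X).Lout ∧
      ((G.add H).add X).Rout = ((H.add G).add X).Rout := by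
  induction G using opt_induction generalizing H X with
  | h G gl gr =>
    induction H using opt_induction generalizing X with
    | h H hl hr =>
      induction X using opt_induction with
      | h X xl xr =>
        constructor
        · refine Lout_eq ?_ ?_ fun x => ?_
          · simp only [add_eq_int_iff]; grind
          · simp only [add_eq_int_iff]; grind
          · simp only [lopts_add, List.map_append, List.map_map, List.mem_append, List.mem_map]
            constructor
            · rintro ⟨_, ((⟨g, hg, rfl⟩ | ⟨g, hg, rfl⟩) | ⟨g, hg, rfl⟩), rfl⟩
              · exact ⟨_, Or.inl (Or.inr ⟨g, hg, rfl⟩), (gl g hg H X).2.symm⟩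
              · exact ⟨_, Or.inl (Or.inl ⟨g, hg, rfl⟩), (hl g hg X).2.symm⟩
              · exact ⟨_, Or.inr ⟨g, hg, rfl⟩, (xl g hg).2.symm⟩
            · rintro ⟨_, ((⟨g, hg, rfl⟩ | ⟨g, hg, rfl⟩) | ⟨g, hg, rfl⟩), rfl⟩
              · exact ⟨_, Or.inl (Or.inr ⟨g, hg, rfl⟩), (hl g hg X).2⟩
              · exact ⟨_, Or.inl (Or.inl ⟨g, hg, rfl⟩), (gl g hg H X).2⟩
              · exact ⟨_, Or.inr ⟨g, hg, rfl⟩, (xl g hg).2⟩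
        · refine Rout_eq ?_ ?_ fun x => ?_
          · simp only [add_eq_int_iff]; grind
          · simp only [add_eq_int_iff]; grind
          · simp only [ropts_add, List.map_append, List.map_map, List.mem_append, List.mem_map]
            constructor
            · rintro ⟨_, ((⟨g, hg, rfl⟩ | ⟨g, hg, rfl⟩) | ⟨g, hg, rfl⟩), rfl⟩
              · exact ⟨_, Or.inl (Or.inr ⟨g, hg, rfl⟩), (gr g hg H X).1.symm⟩
              · exact ⟨_, Or.inl (Or.inl ⟨g, hg, rfl⟩), (hr g hg X).1.symm⟩
              · exact ⟨_, Or.inr ⟨g, hg, rfl⟩, (xr g hg).1.symm⟩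
            · rintro ⟨_, ((⟨g, hg, rfl⟩ | ⟨g, hg, rfl⟩) | ⟨g, hg, rfl⟩), rfl⟩
              · exact ⟨_, Or.inl (Or.inr ⟨g, hg, rfl⟩), (hr g hg X).1⟩
              · exact ⟨_, Or.inl (Or.inl ⟨g, hg, rfl⟩), (gr g hg H X).1⟩
              · exact ⟨_, Or.inr ⟨g, hg, rfl⟩, (xr g hg).1⟩

theorem out_add_comm (G H : WT) :
    (G.add H).Lout = (H.add G).Lout ∧ (G.add H).Rout = (H.add G).Rout := by
  simpa [add_zero] using out_add_comm_add G H (int 0)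

/-! ### Equivalence -/

theorem Equiv.symm {G H : WT} (h : Equiv G H) : Equiv H G :=
  fun X hX => ⟨(h X hX).1.symm, (h X hX).2.symm⟩

theorem Equiv.trans {G H K : WT} (h : Equiv G H) (h' : Equiv H K) : Equiv G K :=
  fun X hX => ⟨(h X hX).1.trans (h' X hX).1, (h X hX).2.trans (h' X hX).2⟩

theorem equiv_add_comm (G H : WT) : Equiv (G.add H) (H.add G) :=
  fun X _ => out_add_comm_add G H X

theorem Equiv.add_right {G H K : WT} (h : Equiv G H) (hK : K.Wt) :
    Equiv (G.add K) (H.add K) := fun X hX => by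
  simpa only [add_assoc] using h (K.add X) (hK.add hX)

theorem Equiv.add_left {G H K : WT} (h : Equiv G H) (hK : K.Wt) :
    Equiv (K.add G) (K.add H) :=
  ((equiv_add_comm K G).trans (h.add_right hK)).trans (equiv_add_comm H K)

theorem Equiv.neg {G H : WT} (h : Equiv G H) : Equiv G.neg H.neg := fun X hX => by
  obtain ⟨h₁, h₂⟩ := h X.neg hX.neg
  have e : ∀ K : WT, K.neg.add X = (K.add X.neg).neg := fun K => by rw [neg_add, neg_neg]
  rw [e, e, Lout_neg, Lout_neg, Rout_neg, Rout_neg, h₁, h₂]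
  exact ⟨rfl, rfl⟩

theorem Equiv.out_eq {G H : WT} (h : Equiv G H) : G.Lout = H.Lout ∧ G.Rout = H.Rout := by
  simpa [add_zero] using h (WT.int 0) (Wt.int 0)

/-! ### Games with nonpositive even gaps -/

/-- Every even-tempered subgame `H` of `G` satisfies `R(H) ≤ L(H)`. -/
def NoEvenGap (G : WT) : Prop := ∀ H : WT, Subgame H G → IsWT H false → H.Rout ≤ H.Lout

theorem NoEvenGap.lopt {G g : WT} (h : NoEvenGap G) (hg : g ∈ G.lopts) : NoEvenGap g := by
  cases G with
  | int n => simp [lopts] at hg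
  | node L R => exact fun H hH => h H (.left hg hH)

theorem NoEvenGap.ropt {G g : WT} (h : NoEvenGap G) (hg : g ∈ G.ropts) : NoEvenGap g := by
  cases G with
  | int n => simp [ropts] at hg
  | node L R => exact fun H hH => h H (.right hg hH)

theorem NoEvenGap.mk {G : WT} (h : IsWT G false → G.Rout ≤ G.Lout)
    (hl : ∀ g ∈ G.lopts, NoEvenGap g) (hr : ∀ g ∈ G.ropts, NoEvenGap g) : NoEvenGap G := by
  intro H hH
  cases hH with
  | refl => exact h
  | left hg hH => exact hl _ hg H hH
  | right hg hH => exact hr _ hg H hH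

theorem NoEvenGap.int (n : ℤ) : NoEvenGap (int n) :=
  .mk (fun _ => by rw [Lout_int, Rout_int]) (by simp [lopts]) (by simp [ropts])

theorem NoEvenGap.neg {G : WT} (h : NoEvenGap G) : NoEvenGap G.neg := by
  induction G using opt_induction with
  | h G gl gr =>
    refine .mk (fun hG => ?_) ?_ ?_
    · have := h G (.refl G) (by simpa [neg_neg] using hG.neg)
      rw [Rout_neg, Lout_neg]
      omega
    · rw [lopts_neg]
      simpa using fun g hg => gr g hg (h.ropt hg)
    · rw [ropts_neg]
      simpa using fun g hg => gl g hg (h.lopt hg)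

theorem NoEvenGap.le_out_add {G : WT} (h : NoEvenGap G) {q : Bool} {X : WT} (hX : IsWT X q) :
    (IsWT G false → G.Rout + X.Rout ≤ (G.add X).Rout ∧ G.Rout + X.Lout ≤ (G.add X).Lout) ∧
      (IsWT G true → G.Lout + X.Rout ≤ (G.add X).Lout) := by
  induction G using opt_induction generalizing X q with
  | h G gl gr =>
    induction X using opt_induction generalizing q with
    | h X xl xr =>
      refine ⟨fun hG => ⟨?_, ?_⟩, fun hG => ?_⟩
      · refine le_Rout_add hG hX (fun g hg => ?_) (fun x hx => ?_) ?_
        · exact le_trans (by linarith [Rout_le_Lout_of_mem_ropts hg])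
            ((gr g hg (h.ropt hg) hX).2 (hG.ropt hg))
        · exact le_trans (by linarith [Rout_le_Lout_of_mem_ropts hx])
            ((xr x hx (hX.ropt hx)).1 hG).2
        · rintro m n rfl rfl
          rw [Rout_int, Rout_int]
      · rcases hX.eq_int_or with ⟨n, rfl⟩ | ⟨hl, _⟩
        · rw [(out_add_int hG n).1, Lout_int]
          linarith [h G (.refl G) hG]
        · obtain ⟨x, hx, e⟩ := exists_Rout_eq_Lout hl
          rw [← e]
          exact ((xl x hx (hX.lopt hx)).1 hG).1.trans (le_Lout_add_right G hx)
      · obtain ⟨g, hg, e⟩ := exists_Rout_eq_Lout hG.lopts_ne_nil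
        rw [← e]
        exact ((gl g hg (h.lopt hg) hX).1 (hG.lopt hg)).1.trans (le_Lout_add_left X hg)

theorem NoEvenGap.out_add_le {G : WT} (h : NoEvenGap G) {q : Bool} {X : WT} (hX : IsWT X q) :
    (IsWT G false → (G.add X).Lout ≤ G.Lout + X.Lout ∧ (G.add X).Rout ≤ G.Lout + X.Rout) ∧
      (IsWT G true → (G.add X).Rout ≤ G.Rout + X.Lout) := by
  have := h.neg.le_out_add hX.neg
  simp only [← neg_add, Lout_neg, Rout_neg] at this
  refine ⟨fun hG => ?_, fun hG => ?_⟩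
  · have := this.1 hG.neg
    constructor <;> linarith
  · have := this.2 hG.neg
    linarith

theorem NoEvenGap.add {G H : WT} {p q : Bool} (hG : NoEvenGap G) (hH : NoEvenGap H)
    (wG : IsWT G p) (wH : IsWT H q) : NoEvenGap (G.add H) := by
  induction G using opt_induction generalizing H p q with
  | h G gl gr =>
    induction H using opt_induction generalizing q with
    | h H hl hr =>
      refine .mk (fun w => ?_) ?_ ?_
      · have e := w.unique (wG.add wH)
        have c := (out_add_comm H G).2
        cases p <;> cases q <;> simp at e
        · linarith [((hG.le_out_add wH).1 wG).2, ((hH.out_add_le wG).1 wH).2]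
        · linarith [(hG.le_out_add wH).2 wG, (hH.out_add_le wG).2 wH]
      · simp only [lopts_add, List.mem_append, List.mem_map]
        rintro _ (⟨g, hg, rfl⟩ | ⟨g, hg, rfl⟩)
        · exact gl g hg (hG.lopt hg) hH (wG.lopt hg) wH
        · exact hl g hg (hH.lopt hg) (wH.lopt hg)
      · simp only [ropts_add, List.mem_append, List.mem_map]
        rintro _ (⟨g, hg, rfl⟩ | ⟨g, hg, rfl⟩)
        · exact gr g hg (hG.ropt hg) hH (wG.ropt hg) wH
        · exact hr g hg (hH.ropt hg) (wH.ropt hg)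

theorem NoEvenGap.equiv_zero {G : WT} (h : NoEvenGap G) (w : IsWT G false)
    (hR : 0 ≤ G.Rout) (hL : G.Lout ≤ 0) : Equiv G (WT.int 0) := by
  rintro X ⟨q, hX⟩
  have h₁ := (h.le_out_add hX).1 w
  have h₂ := (h.out_add_le hX).1 w
  rw [zero_add]
  constructor <;> linarith

/-- The player moving second can mirror the moves of the opponent in `G - G`. -/
theorem Rout_add_neg_nonneg {G : WT} {p : Bool} (w : IsWT G p) : 0 ≤ (G.add G.neg).Rout := by
  induction G using opt_induction generalizing p with
  | h G gl gr =>
    refine le_Rout_add w w.neg (fun g hg => ?_) (fun x hx => ?_) ?_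
    · refine (gr g hg (w.ropt hg)).trans (le_Lout_add_right g ?_)
      rw [lopts_neg]
      exact List.mem_map_of_mem hg
    · rw [ropts_neg] at hx
      obtain ⟨g, hg, rfl⟩ := List.mem_map.1 hx
      exact (gl g hg (w.lopt hg)).trans (le_Lout_add_left _ hg)
    · rintro m n rfl e
      rw [neg_int] at e
      cases e
      simp

theorem NoEvenGap.add_neg_equiv_zero {G : WT} (h : NoEvenGap G) (w : G.Wt) :
    Equiv (G.add G.neg) (WT.int 0) := by
  obtain ⟨p, w⟩ := w
  have w' : IsWT (G.add G.neg) false := by simpa using w.add w.neg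
  refine (h.add h.neg w w.neg).equiv_zero w' (Rout_add_neg_nonneg w) ?_
  have := Rout_add_neg_nonneg w
  rw [← (out_add_comm _ _).2, ← neg_neg (G.neg.add G), neg_add, neg_neg, Rout_neg] at this
  linarith

/-! ### The gap -/

theorem finite_subgames (G : WT) : {H | Subgame H G}.Finite := by
  induction G using opt_induction with
  | h G gl gr =>
    refine ((Set.finite_singleton G).union
      (((List.finite_toSet G.lopts).biUnion gl).union
        ((List.finite_toSet G.ropts).biUnion gr))).subset fun H hH => ?_
    cases hH with
    | refl => simp
    | left hg hH => exact Or.inr (Or.inl (Set.mem_biUnion hg hH))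
    | right hg hH => exact Or.inr (Or.inr (Set.mem_biUnion hg hH))

theorem IsWT.exists_int_subgame {G : WT} {p : Bool} (w : IsWT G p) :
    ∃ n, Subgame (WT.int n) G := by
  induction w with
  | int n => exact ⟨n, .refl _⟩
  | @node L R p hL _ _ _ ih _ =>
    obtain ⟨g, hg⟩ := List.exists_mem_of_ne_nil L hL
    obtain ⟨n, hn⟩ := ih g hg
    exact ⟨n, .left hg hn⟩

theorem gap_false_eq_zero_iff {G : WT} (w : G.Wt) :
    G.gap false = ((0 : ℤ) : WithBot ℤ) ↔ NoEvenGap G := by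
  constructor
  · intro h H hH wH
    have hb : BddAbove {x : WithBot ℤ | ∃ H : WT, Subgame H G ∧ IsWT H false ∧
        x = ((H.Rout - H.Lout : ℤ) : WithBot ℤ)} := by
      refine Set.Finite.bddAbove (((finite_subgames G).image
        fun H => ((H.Rout - H.Lout : ℤ) : WithBot ℤ)).subset ?_)
      rintro _ ⟨H, hH, _, rfl⟩
      exact ⟨H, hH, rfl⟩
    have := le_csSup hb ⟨H, hH, wH, rfl⟩
    rw [← gap, h, WithBot.coe_le_coe] at this
    linarith
  · intro h
    refine IsGreatest.csSup_eq ⟨?_, ?_⟩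
    · obtain ⟨n, hn⟩ := w.choose_spec.exists_int_subgame
      exact ⟨_, hn, .int n, by simp [Rout_int, Lout_int]⟩
    · rintro _ ⟨H, hH, wH, rfl⟩
      rw [WithBot.coe_le_coe]
      linarith [h H hH wH]

/-! ### An odd-tempered game is not equivalent to zero -/

/-- The value when Left moves last, for a game of parity `s`. -/
def leftLast (s : Bool) (G : WT) : ℤ := bif s then G.Lout else G.Rout

theorem leftLast_not (s : Bool) (G : WT) : leftLast (!s) G = -leftLast s G.neg := by
  cases s <;> simp [leftLast, Lout_neg, Rout_neg]

theorem leftLast_congr {G H : WT} (h : G.Lout = H.Lout ∧ G.Rout = H.Rout) (s : Bool) :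
    leftLast s G = leftLast s H := by
  cases s <;> simp [leftLast, h.1, h.2]

/-- The zugzwang `{-N | N}`. -/
def zugzwang (N : ℤ) : WT := node [int (-N)] [int N]

theorem isWT_zugzwang (N : ℤ) : IsWT (zugzwang N) true :=
  .node' (by simp) (by simp) (by simpa using .int _) (by simpa using .int _)

theorem exists_le_leftLast_add_zugzwang {G : WT} {p : Bool} (w : IsWT G p) :
    ∃ c, ∀ N, N - c ≤ leftLast p (G.add (zugzwang N)) := by
  induction G using opt_induction generalizing p with
  | h G gl gr =>
    have bound : ∃ c, ∀ g ∈ G.ropts, ∀ N, N - c ≤ leftLast (!p) (g.add (zugzwang N)) := by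
      choose! f hf using fun g hg => gr g hg (w.ropt hg)
      obtain ⟨c, hc⟩ := ((List.finite_toSet G.ropts).image f).bddAbove
      refine ⟨c, fun g hg N => le_trans ?_ (hf g hg N)⟩
      linarith [hc (Set.mem_image_of_mem f hg)]
    cases p with
    | true =>
      obtain ⟨g, hg⟩ := List.exists_mem_of_ne_nil _ w.lopts_ne_nil
      obtain ⟨c, hc⟩ := gl g hg (w.lopt hg)
      exact ⟨c, fun N => (hc N).trans (le_Lout_add_left _ hg)⟩
    | false =>
      obtain ⟨c, hc⟩ := bound
      refine ⟨max c (-G.Lout), fun N => ?_⟩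
      have := le_max_left c (-G.Lout)
      have := le_max_right c (-G.Lout)
      refine le_Rout_add w (isWT_zugzwang N) (fun g hg => ?_) (fun x hx => ?_) ?_
      · exact le_trans (by linarith) (hc g hg N)
      · obtain rfl : x = WT.int N := by simpa [zugzwang, ropts] using hx
        rw [(out_add_int w N).1]
        linarith
      · rintro m n rfl e
        cases e

theorem IsWT.not_equiv_zero {G : WT} (w : IsWT G true) : ¬ Equiv G (WT.int 0) := by
  intro h
  obtain ⟨c, hc⟩ := exists_le_leftLast_add_zugzwang w
  have h₁ := hc (|c| + 1)
  have h₂ := (h (zugzwang (|c| + 1)) ⟨_, isWT_zugzwang _⟩).1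
  simp only [leftLast, cond_true] at h₁
  rw [h₂, zero_add, zugzwang, Lout_node] at h₁
  simp only [List.map_cons, List.map_nil, lmax, List.foldl_nil, Rout_int] at h₁
  linarith [le_abs_self c, abs_nonneg c]

/-! ### Replacing a game by one without even gaps when Left moves last -/

/-- `G` and `K`, both of parity `p`, have the same value in every sum where Left moves last. -/
def LeftLastEquiv (p : Bool) (G K : WT) : Prop :=
  ∀ (q : Bool) (X : WT), IsWT X q → leftLast (p ^^ q) (G.add X) = leftLast (p ^^ q) (K.add X)

theorem LeftLastEquiv.trans {p : Bool} {G H K : WT} (h : LeftLastEquiv p G H)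
    (h' : LeftLastEquiv p H K) : LeftLastEquiv p G K :=
  fun q X hX => (h q X hX).trans (h' q X hX)

theorem leftLast_node_true (L R : List WT) :
    leftLast true (node L R) = lmax (L.map (leftLast false)) := Lout_node L R

theorem leftLast_node_false (L R : List WT) :
    leftLast false (node L R) = lmin (R.map (leftLast true)) := Rout_node L R

theorem LeftLastEquiv.node_map {p : Bool} {L R : List WT} {f : WT → WT}
    (hL : ∀ g ∈ L, LeftLastEquiv (!p) g (f g)) (hR : ∀ g ∈ R, LeftLastEquiv (!p) g (f g)) :
    LeftLastEquiv p (WT.node L R) (WT.node (L.map f) (R.map f)) := by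
  intro q X hX
  induction X using opt_induction generalizing q with
  | h X xl xr =>
    rw [node_add, node_add]
    cases hs : p ^^ q
    · rw [leftLast_node_false, leftLast_node_false]
      simp only [List.map_append, List.map_map]
      congr 2
      · refine List.map_congr_left fun g hg => ?_
        simpa [hs] using hR g hg q X hX
      · refine List.map_congr_left fun x hx => ?_
        simpa [hs] using xr x hx _ (hX.ropt hx)
    · rw [leftLast_node_true, leftLast_node_true]
      simp only [List.map_append, List.map_map]
      congr 2
      · refine List.map_congr_left fun g hg => ?_
        simpa [hs] using hL g hg q X hX
      · refine List.map_congr_left fun x hx => ?_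
        simpa [hs] using xl x hx _ (hX.lopt hx)

theorem leftLastEquiv_int {G : WT} (w : IsWT G false) (hl : ∀ g ∈ G.lopts, NoEvenGap g)
    (hr : ∀ g ∈ G.ropts, NoEvenGap g) (hlt : G.Lout ≤ G.Rout) :
    LeftLastEquiv false G (WT.int G.Rout) := by
  intro q X hX
  suffices h : leftLast q (G.add X) = G.Rout + leftLast q X by
    have e := out_add_int hX G.Rout
    rw [Bool.false_xor, h, leftLast_congr (out_add_comm (WT.int G.Rout) X)]
    cases q <;> simp [leftLast, e.1, e.2, add_comm]
  induction X using opt_induction generalizing q with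
  | h X xl xr =>
    cases q with
    | false =>
      simp only [leftLast, cond_false] at xr ⊢
      apply le_antisymm
      · rcases hX.eq_int_or with ⟨n, rfl⟩ | ⟨_, h⟩
        · rw [(out_add_int w n).2, Rout_int]
        · obtain ⟨x, hx, e⟩ := exists_Lout_eq_Rout h
          have := xr x hx _ (hX.ropt hx)
          simp only [Bool.not_false, cond_true] at this
          rw [← e, ← this]
          exact Rout_add_le_right G hx
      · refine le_Rout_add w hX (fun g hg => ?_) (fun x hx => ?_) ?_
        · exact le_trans (by linarith [Rout_le_Lout_of_mem_ropts hg])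
            (((hr g hg).le_out_add hX).2 (w.ropt hg))
        · have := xr x hx _ (hX.ropt hx)
          simp only [Bool.not_false, cond_true] at this
          linarith [Rout_le_Lout_of_mem_ropts hx]
        · rintro m n rfl rfl
          rw [Rout_int, Rout_int]
    | true =>
      simp only [leftLast, cond_true] at xl ⊢
      apply le_antisymm
      · refine Lout_add_le w hX (fun g hg => ?_) (fun x hx => ?_) ?_
        · exact le_trans (((hl g hg).out_add_le hX).2 (w.lopt hg))
            (by linarith [Rout_le_Lout_of_mem hg])
        · have := xl x hx _ (hX.lopt hx)
          simp only [Bool.not_true, cond_false] at this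
          linarith [Rout_le_Lout_of_mem hx]
        · rintro m n rfl rfl
          cases hX
      · obtain ⟨x, hx, e⟩ := exists_Rout_eq_Lout hX.lopts_ne_nil
        have := xl x hx _ (hX.lopt hx)
        simp only [Bool.not_true, cond_false] at this
        rw [← e, ← this]
        exact le_Lout_add_right G hx

theorem exists_leftLastEquiv_noEvenGap {G : WT} {p : Bool} (w : IsWT G p) :
    ∃ K, IsWT K p ∧ NoEvenGap K ∧ LeftLastEquiv p G K := by
  induction w with
  | int n => exact ⟨WT.int n, .int n, .int n, fun _ _ _ => rfl⟩
  | @node L R p hL hR _ _ ihL ihR =>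
    have ih : ∀ g, g ∈ L ∨ g ∈ R → ∃ K, IsWT K p ∧ NoEvenGap K ∧ LeftLastEquiv p g K :=
      fun g hg => hg.elim (ihL g) (ihR g)
    choose! f hf using ih
    have w' : IsWT (WT.node (L.map f) (R.map f)) (!p) :=
      .node (by simpa using hL) (by simpa using hR)
        (by simpa using fun g hg => (hf g (Or.inl hg)).1)
        (by simpa using fun g hg => (hf g (Or.inr hg)).1)
    have e : LeftLastEquiv (!p) (WT.node L R) (WT.node (L.map f) (R.map f)) :=
      .node_map (by simpa using fun g hg => (hf g (Or.inl hg)).2.2)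
        (by simpa using fun g hg => (hf g (Or.inr hg)).2.2)
    have gl : ∀ g ∈ (WT.node (L.map f) (R.map f)).lopts, NoEvenGap g := by
      simpa [lopts] using fun g hg => (hf g (Or.inl hg)).2.1
    have gr : ∀ g ∈ (WT.node (L.map f) (R.map f)).ropts, NoEvenGap g := by
      simpa [ropts] using fun g hg => (hf g (Or.inr hg)).2.1
    generalize WT.node (L.map f) (R.map f) = K at w' e gl gr
    by_cases h : IsWT K false → K.Rout ≤ K.Lout
    · exact ⟨K, w', .mk h gl gr, e⟩
    · push Not at h
      obtain ⟨h₀, h⟩ := h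
      rw [w'.unique h₀] at e ⊢
      exact ⟨WT.int K.Rout, .int _, .int _, e.trans (leftLastEquiv_int h₀ gl gr h.le)⟩

/-! ### Invertible games -/

theorem add_equiv_zero_of_leftLastEquiv {G H P Q : WT} {p : Bool}
    (wG : IsWT G p) (h : Equiv (G.add H) (WT.int 0))
    (wP : IsWT P p) (wQ : IsWT Q p) (hP : NoEvenGap P) (hQ : NoEvenGap Q)
    (eP : LeftLastEquiv p G P) (eQ : LeftLastEquiv p H Q) : Equiv (P.add Q) (WT.int 0) := by
  have w : IsWT (P.add Q) false := by simpa using wP.add wQ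
  have key : ∀ X q, IsWT X q → leftLast q ((P.add Q).add X) = leftLast q X := by
    intro X q hX
    have h₁ := eP _ _ (wQ.add hX)
    have h₂ := eQ _ _ (wG.add hX)
    simp only [← Bool.xor_assoc, Bool.xor_self, Bool.false_xor, ← add_assoc] at h₁ h₂
    rw [← h₁, leftLast_congr (out_add_comm_add G Q X), ← h₂,
      leftLast_congr (out_add_comm_add H G X), leftLast_congr (h X ⟨q, hX⟩), zero_add]
  have hg := hP.add hQ wP wQ
  have h₀ := key (WT.int 0) false (.int 0)
  have h₁ := key (P.add Q).neg false w.neg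
  rw [leftLast_congr (hg.add_neg_equiv_zero ⟨_, w⟩).out_eq] at h₁
  simp only [leftLast, cond_false, add_zero, Rout_int, Rout_neg] at h₀ h₁
  exact hg.equiv_zero w h₀.ge (by linarith)

theorem exists_noEvenGap_equiv {G H : WT} (hG : G.Wt) (hH : H.Wt)
    (h : Equiv (G.add H) (WT.int 0)) : ∃ K : WT, K.Wt ∧ NoEvenGap K ∧ Equiv G K := by
  obtain ⟨p, wG⟩ := hG
  obtain ⟨q, wH⟩ := hH
  obtain rfl : p = q := by
    have w := wG.add wH
    cases p <;> cases q <;> first | rfl | exact absurd h w.not_equiv_zero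
  obtain ⟨P, wP, gP, eP⟩ := exists_leftLastEquiv_noEvenGap wG
  obtain ⟨N, wN, gN, eN⟩ := exists_leftLastEquiv_noEvenGap wG.neg
  obtain ⟨P', wP', gP', eP'⟩ := exists_leftLastEquiv_noEvenGap wH
  obtain ⟨N', wN', gN', eN'⟩ := exists_leftLastEquiv_noEvenGap wH.neg
  have hP := add_equiv_zero_of_leftLastEquiv wG h wP wP' gP gP' eP eP'
  have hN := add_equiv_zero_of_leftLastEquiv wG.neg
    (by simpa [neg_add, neg_int] using h.neg) wN wN' gN gN' eN eN'
  have nonneg : ∀ {A B C : WT}, IsWT A p → IsWT C p → LeftLastEquiv p A B →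
      LeftLastEquiv p A.neg C → 0 ≤ (B.add C).Rout := by
    intro A B C wA wC eB eC
    have h₁ := eB p C wC
    have h₂ := eC p A wA
    simp only [Bool.xor_self, leftLast, cond_false] at h₁ h₂
    rw [← h₁, (out_add_comm A C).2, ← h₂, (out_add_comm A.neg A).2]
    exact Rout_add_neg_nonneg wA
  have wPN : IsWT (P.add N) false := by simpa using wP.add wN
  have wPN' : IsWT (P'.add N') false := by simpa using wP'.add wN'
  have hle : (P.add N).Lout ≤ 0 := by
    have h₁ := (((gP'.add gN' wP' wN').le_out_add wPN).1 wPN').2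
    have h₂ := nonneg wH wN' eP' eN'
    have h₃ : Equiv ((P'.add N').add (P.add N)) (WT.int 0) := by
      have e₁ : Equiv ((P'.add N').add (P.add N)) ((P.add N).add (P'.add N')) :=
        equiv_add_comm _ _
      have e₂ : Equiv ((P.add N).add (P'.add N')) ((P.add P').add (N.add N')) := by
        rw [add_assoc, add_assoc, ← add_assoc N, ← add_assoc P']
        exact ((equiv_add_comm N P').add_right ⟨_, wN'⟩).add_left ⟨_, wP⟩
      have e₃ := hP.add_right (K := N.add N') ⟨_, wN.add wN'⟩
      rw [zero_add] at e₃
      exact ((e₁.trans e₂).trans e₃).trans hN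
    have h₄ := h₃.out_eq.1
    rw [Lout_int] at h₄
    linarith
  have hPN := (gP.add gN wP wN).equiv_zero wPN (nonneg wG wN eP eN) hle
  have hPneg : Equiv P N.neg := by
    have e₁ := (gN.add_neg_equiv_zero ⟨_, wN⟩).add_left (K := P) ⟨_, wP⟩
    have e₂ := hPN.add_right (K := N.neg) ⟨_, wN.neg⟩
    rw [add_zero] at e₁
    rw [zero_add, add_assoc] at e₂
    exact e₁.symm.trans e₂
  refine ⟨P, ⟨_, wP⟩, gP, ?_⟩
  rintro X ⟨q, hX⟩
  have h₁ := eP q X hX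
  have h₂ : leftLast (!(p ^^ q)) (G.add X) = leftLast (!(p ^^ q)) (P.add X) := by
    rw [leftLast_congr (hPneg X ⟨q, hX⟩), leftLast_not, leftLast_not, neg_add, neg_add, neg_neg,
      eN q X.neg hX.neg]
  cases hs : p ^^ q <;> rw [hs] at h₁ h₂ <;> exact ⟨by assumption, by assumption⟩

end WT

/-- G is invertible iff G ≈ K for some K with gap₀(K) = 0, iff G - G ≈ 0. -/
theorem invertibility_characterization (G : WT) (hG : G.Wt) :
    ((∃ H : WT, H.Wt ∧ WT.Equiv (G.add H) (WT.int 0)) ↔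
      (∃ K : WT, K.Wt ∧ K.gap false = ((0 : ℤ) : WithBot ℤ) ∧ WT.Equiv G K)) ∧
    ((∃ H : WT, H.Wt ∧ WT.Equiv (G.add H) (WT.int 0)) ↔
      WT.Equiv (G.add G.neg) (WT.int 0)) := by
  have h₁ : (∃ H : WT, H.Wt ∧ WT.Equiv (G.add H) (WT.int 0)) →
      ∃ K : WT, K.Wt ∧ K.gap false = ((0 : ℤ) : WithBot ℤ) ∧ WT.Equiv G K := by
    rintro ⟨H, hH, h⟩
    obtain ⟨K, hK, gK, e⟩ := WT.exists_noEvenGap_equiv hG hH h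
    exact ⟨K, hK, (WT.gap_false_eq_zero_iff hK).2 gK, e⟩
  have h₂ : (∃ K : WT, K.Wt ∧ K.gap false = ((0 : ℤ) : WithBot ℤ) ∧ WT.Equiv G K) →
      WT.Equiv (G.add G.neg) (WT.int 0) := by
    rintro ⟨K, hK, gK, e⟩
    exact ((e.add_right hG.neg).trans (e.neg.add_left hK)).trans
      (((WT.gap_false_eq_zero_iff hK).1 gK).add_neg_equiv_zero hK)
  have h₃ : WT.Equiv (G.add G.neg) (WT.int 0) →
      ∃ H : WT, H.Wt ∧ WT.Equiv (G.add H) (WT.int 0) := fun h => ⟨G.neg, hG.neg, h⟩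
  exact ⟨⟨h₁, fun h => h₃ (h₂ h)⟩, ⟨fun h => h₂ (h₁ h), h₃⟩⟩
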